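/- There exist a constant c > 0 and t₀ ∈ ℕ such that for every integer t ≥ t₀, the group G = (ℤ/2ℤ)^t × ℤ/4ℤ satisfies f_max(G) ≤ 2^{(1/2 − c)·μ(G)}; that is, f_max(G) is exponentially smaller than 2^{μ(G)/2}. -/

import Mathlib

/-- A subset `A` of an additive group is *sum-free* if there are no
`x, y, z ∈ A` (not necessarily distinct) with `x + y = z`. -/
def IsSumFree {G : Type*} [AddCommGroup G] (A : Set G) : Prop :=
  ∀ x ∈ A, ∀ y ∈ A, x + y ∉ A

/-- `A` is a maximal sum-free subset of `G`. -/
def IsMaximalSumFree {G : Type*} [AddCommGroup G] (A : Set G) : Prop :=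
  IsSumFree A ∧ ∀ B : Set G, IsSumFree B → A ⊆ B → A = B

/-- `μ(G)`: the maximum size of a sum-free subset of `G`. -/
noncomputable def sumFreeMu (G : Type*) [AddCommGroup G] [Fintype G] : ℕ :=
  sSup {k : ℕ | ∃ A : Set G, IsSumFree A ∧ A.ncard = k}

/-- `f_max(G)`: the number of maximal sum-free subsets of `G`. -/
noncomputable def fMaxSF (G : Type*) [AddCommGroup G] [Fintype G] : ℕ :=
  Nat.card {A : Set G // IsMaximalSumFree A}

namespace SumFree

open Finset

section MaximalIndependent

variable {α : Type*} [DecidableEq α]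

open scoped Classical in
/-- The maximal independent subsets of `V` with respect to the relation `r`. -/
noncomputable def maximalIndep (r : α → α → Prop) (V : Finset α) : Finset (Finset α) :=
  V.powerset.filter fun I ↦
    (∀ x ∈ I, ∀ y ∈ I, ¬ r x y) ∧ ∀ x ∈ V, x ∉ I → ∃ y ∈ I, r x y

lemma mem_maximalIndep {r : α → α → Prop} {V I : Finset α} :
    I ∈ maximalIndep r V ↔
      I ⊆ V ∧ (∀ x ∈ I, ∀ y ∈ I, ¬ r x y) ∧ ∀ x ∈ V, x ∉ I → ∃ y ∈ I, r x y := by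
  simp [maximalIndep]

/-- A Moon–Moser type bound: a graph on `m` vertices has at most `c ^ m` maximal independent sets
as soon as `k ≤ c ^ k` for all natural numbers `k`. -/
theorem card_maximalIndep_le {r : α → α → Prop} (hsymm : ∀ x y, r x y → r y x)
    {c : ℝ} (hc₁ : 1 ≤ c) (hc : ∀ k : ℕ, (k : ℝ) ≤ c ^ k) (V : Finset α) :
    (#(maximalIndep r V) : ℝ) ≤ c ^ #V := by
  classical
  induction V using Finset.strongInduction with
  | H V ih =>
  rcases V.eq_empty_or_nonempty with rfl | hV
  · have : maximalIndep r (∅ : Finset α) ⊆ {∅} := fun I hI ↦ by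
      simpa using (mem_maximalIndep.1 hI).1
    simpa using card_le_card this
  let N : α → Finset α := fun u ↦ V.filter fun y ↦ y = u ∨ r u y
  obtain ⟨v, hv, hmin⟩ := V.exists_min_image (fun u ↦ #(N u)) hV
  have hNV (u) : N u ⊆ V := filter_subset _ _
  have hcover : maximalIndep r V ⊆
      (N v).biUnion fun u ↦ (maximalIndep r V).filter fun I ↦ u ∈ I := by
    intro I hI
    obtain ⟨hIV, -, hmax⟩ := mem_maximalIndep.1 hI
    simp only [mem_biUnion, mem_filter, N]
    by_cases hvI : v ∈ I
    · exact ⟨v, ⟨hv, .inl rfl⟩, hI, hvI⟩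
    · obtain ⟨y, hy, hry⟩ := hmax v hv hvI
      exact ⟨y, ⟨hIV hy, .inr hry⟩, hI, hy⟩
  have hpiece : ∀ u ∈ N v, (#((maximalIndep r V).filter fun I ↦ u ∈ I) : ℝ) ≤
      c ^ (#V - #(N v)) := by
    intro u hu
    have huV : u ∈ V := hNV v hu
    have huN : u ∈ N u := by simp [N, huV]
    have hle : #((maximalIndep r V).filter fun I ↦ u ∈ I) ≤ #(maximalIndep r (V \ N u)) := by
      refine card_le_card_of_injOn (fun I ↦ I.erase u) ?_ ?_
      · intro I hI
        simp only [coe_filter, Set.mem_ofPred_eq] at hI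
        obtain ⟨hI, huI⟩ := hI
        obtain ⟨hIV, hind, hmax⟩ := mem_maximalIndep.1 hI
        refine mem_maximalIndep.2 ⟨?_, ?_, ?_⟩
        · intro x hx
          obtain ⟨hxu, hx⟩ := mem_erase.1 hx
          simp only [N, mem_sdiff, mem_filter, not_and, not_or]
          exact ⟨hIV hx, fun _ ↦ ⟨hxu, hind u huI x hx⟩⟩
        · exact fun x hx y hy ↦ hind x (mem_of_mem_erase hx) y (mem_of_mem_erase hy)
        · intro x hx hxI
          simp only [N, mem_sdiff, mem_filter, not_and, not_or] at hx
          obtain ⟨hxV, hxN⟩ := hx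
          obtain ⟨hxu, hrx⟩ := hxN hxV
          obtain ⟨y, hy, hxy⟩ := hmax x hxV fun h ↦ hxI (mem_erase.2 ⟨hxu, h⟩)
          refine ⟨y, mem_erase.2 ⟨?_, hy⟩, hxy⟩
          rintro rfl
          exact hrx (hsymm _ _ hxy)
      · intro I hI J hJ hIJ
        simp only [coe_filter, Set.mem_ofPred_eq] at hI hJ
        rw [← insert_erase hI.2, ← insert_erase hJ.2]
        exact congrArg _ hIJ
    have hss : V \ N u ⊂ V := sdiff_ssubset (hNV u) ⟨u, huN⟩
    calc (#((maximalIndep r V).filter fun I ↦ u ∈ I) : ℝ)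
        ≤ #(maximalIndep r (V \ N u)) := by exact_mod_cast hle
      _ ≤ c ^ #(V \ N u) := ih _ hss
      _ ≤ c ^ (#V - #(N v)) := by
        refine pow_le_pow_right₀ hc₁ ?_
        rw [card_sdiff_of_subset (hNV u)]
        exact Nat.sub_le_sub_left (hmin u huV) _
  calc (#(maximalIndep r V) : ℝ)
      ≤ ∑ u ∈ N v, (#((maximalIndep r V).filter fun I ↦ u ∈ I) : ℝ) := by
        exact_mod_cast (card_le_card hcover).trans card_biUnion_le
    _ ≤ ∑ _u ∈ N v, c ^ (#V - #(N v)) := sum_le_sum hpiece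
    _ = #(N v) * c ^ (#V - #(N v)) := by simp
    _ ≤ c ^ #(N v) * c ^ (#V - #(N v)) := by gcongr; exact hc _
    _ = c ^ #V := by rw [← pow_add, Nat.add_sub_cancel' (card_le_card (hNV v))]

/-- Removing from a graph vertices that have a twin among the remaining vertices does not decrease
the number of maximal independent sets. -/
theorem card_maximalIndep_le_of_twins {r : α → α → Prop} (hsymm : ∀ x y, r x y → r y x)
    {V V' : Finset α} (hV' : V' ⊆ V)
    (htwin : ∀ y ∈ V, y ∉ V' → ∃ y' ∈ V', ∀ x ∈ V, r x y ↔ r x y') :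
    #(maximalIndep r V) ≤ #(maximalIndep r V') := by
  have hmem : ∀ I ∈ maximalIndep r V, ∀ y ∈ V, ∀ y' ∈ V, (∀ x ∈ V, r x y ↔ r x y') →
      y ∈ I → y' ∈ I := by
    intro I hI y _ y' hy'V hyy' hyI
    obtain ⟨hIV, hind, hmax⟩ := mem_maximalIndep.1 hI
    by_contra hy'
    obtain ⟨z, hz, hrz⟩ := hmax y' hy'V hy'
    exact hind z hz y hyI ((hyy' z (hIV hz)).2 (hsymm _ _ hrz))
  refine card_le_card_of_injOn (fun I ↦ I ∩ V') ?_ ?_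
  · intro I hI
    obtain ⟨hIV, hind, hmax⟩ := mem_maximalIndep.1 hI
    refine mem_maximalIndep.2 ⟨inter_subset_right, ?_, ?_⟩
    · exact fun x hx y hy ↦ hind x (mem_inter.1 hx).1 y (mem_inter.1 hy).1
    · intro x hx hxI
      obtain ⟨y, hyI, hxy⟩ := hmax x (hV' hx) fun h ↦ hxI (mem_inter.2 ⟨h, hx⟩)
      by_cases hyV' : y ∈ V'
      · exact ⟨y, mem_inter.2 ⟨hyI, hyV'⟩, hxy⟩
      · obtain ⟨y', hy', hyy'⟩ := htwin y (hIV hyI) hyV'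
        exact ⟨y', mem_inter.2 ⟨hmem I hI y (hIV hyI) y' (hV' hy') hyy' hyI, hy'⟩,
          (hyy' x (hV' hx)).1 hxy⟩
  · have key : ∀ I ∈ maximalIndep r V, ∀ J ∈ maximalIndep r V, I ∩ V' = J ∩ V' → I ⊆ J := by
      intro I hI J hJ hIJ y hy
      have hyV := (mem_maximalIndep.1 hI).1 hy
      by_cases hyV' : y ∈ V'
      · have : y ∈ J ∩ V' := hIJ ▸ mem_inter.2 ⟨hy, hyV'⟩
        exact (mem_inter.1 this).1
      · obtain ⟨y', hy', hyy'⟩ := htwin y hyV hyV'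
        have h : y' ∈ J ∩ V' :=
          hIJ ▸ mem_inter.2 ⟨hmem I hI y hyV y' (hV' hy') hyy' hy, hy'⟩
        exact hmem J hJ y' (hV' hy') y hyV (fun x hx ↦ (hyy' x hx).symm) (mem_inter.1 h).1
    exact fun I hI J hJ hIJ ↦ (key I hI J hJ hIJ).antisymm (key J hJ I hI hIJ.symm)

end MaximalIndependent

section Link

variable {G : Type*} [AddCommGroup G] [DecidableEq G]

/-- Two distinct elements are linked by `U` if together with an element of `U` they solve
`x + y = z`. -/
def Link (U : Finset G) (x y : G) : Prop :=
  x ≠ y ∧ ∃ u ∈ U, x + y = u ∨ x + u = y ∨ y + u = x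

omit [DecidableEq G] in
lemma Link.symm {U : Finset G} {x y : G} (h : Link U x y) : Link U y x := by
  obtain ⟨hxy, u, hu, h⟩ := h
  refine ⟨hxy.symm, u, hu, ?_⟩
  rw [add_comm y x]
  tauto

open scoped Classical in
/-- The elements of `B` that can be added to `U` keeping it sum-free. -/
noncomputable def linkVertices (B U : Finset G) : Finset G :=
  B.filter fun x ↦ IsSumFree ((insert x U : Finset G) : Set G)

lemma mem_linkVertices {B U : Finset G} {x : G} : x ∈ linkVertices B U ↔
    x ∈ B ∧ ∀ a ∈ insert x U, ∀ b ∈ insert x U, a + b ∉ insert x U := by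
  simp only [linkVertices, IsSumFree, mem_filter, mem_coe]

lemma linkVertices_subset {B U : Finset G} : linkVertices B U ⊆ B :=
  fun _ hx ↦ (mem_linkVertices.1 hx).1

lemma exists_of_not_isSumFree_insert {A : Finset G} (hA : IsMaximalSumFree (A : Set G)) {x : G}
    (hx : x ∉ A) : ∃ a ∈ insert x A, ∃ b ∈ insert x A, a + b ∈ insert x A := by
  by_contra! h
  have := hA.2 ((insert x A : Finset G) : Set G) (fun a ha b hb ↦ h a ha b hb)
    (by exact_mod_cast subset_insert x A)
  rw [coe_inj] at this
  exact hx (this ▸ mem_insert_self x A)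

variable [Fintype G]

variable (G) in
open scoped Classical in
/-- The maximal sum-free subsets, as finsets. -/
noncomputable def maximalSumFree : Finset (Finset G) :=
  univ.filter fun A ↦ IsMaximalSumFree (A : Set G)

omit [DecidableEq G] in
lemma mem_maximalSumFree {A : Finset G} :
    A ∈ maximalSumFree G ↔ IsMaximalSumFree (A : Set G) := by
  simp [maximalSumFree]

omit [DecidableEq G] in
lemma fMaxSF_eq_card : fMaxSF G = #(maximalSumFree G) := by
  classical
  rw [fMaxSF, maximalSumFree, ← Fintype.card_subtype, ← Nat.card_eq_fintype_card]
  exact Nat.card_congr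
    ((Fintype.finsetEquivSet (α := G)).subtypeEquiv fun A ↦ by simp).symm

/-- A maximal sum-free set with prescribed trace `U` outside a sum-free set `B` is determined by a
maximal independent set in the link graph of `U` on `B`. -/
theorem card_filter_sdiff_eq_le {B : Finset G} (hB : IsSumFree (B : Set G)) (U : Finset G) :
    #((maximalSumFree G).filter fun A ↦ A \ B = U) ≤
      #(maximalIndep (Link U) (linkVertices B U)) := by
  refine card_le_card_of_injOn (fun A ↦ A ∩ B) ?_ ?_
  · intro A hA
    simp only [coe_filter, Set.mem_ofPred_eq, mem_maximalSumFree] at hA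
    obtain ⟨hA, rfl⟩ := hA
    have hsf : ∀ a ∈ A, ∀ b ∈ A, a + b ∉ A := hA.1
    have hB' : ∀ a ∈ B, ∀ b ∈ B, a + b ∉ B := hB
    refine mem_maximalIndep.2 ⟨?_, ?_, ?_⟩
    · intro x hx
      obtain ⟨hxA, hxB⟩ := mem_inter.1 hx
      have hsub := insert_subset hxA (sdiff_subset (s := A) (t := B))
      exact mem_linkVertices.2 ⟨hxB, fun a ha b hb hab ↦ hsf a (hsub ha) b (hsub hb) (hsub hab)⟩
    · rintro x hx y hy ⟨-, u, hu, h⟩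
      have hx := (mem_inter.1 hx).1
      have hy := (mem_inter.1 hy).1
      have hu := (mem_sdiff.1 hu).1
      rcases h with rfl | rfl | rfl
      · exact hsf x hx y hy hu
      · exact hsf x hx u hu hy
      · exact hsf y hy u hu hx
    · intro x hx hxA
      obtain ⟨hxB, hxU⟩ := mem_linkVertices.1 hx
      have hxA : x ∉ A := fun h ↦ hxA (mem_inter.2 ⟨h, hxB⟩)
      obtain ⟨a, ha, b, hb, hab⟩ := exists_of_not_isSumFree_insert hA hxA
      have hne : ∀ y ∈ A, x ≠ y := fun y hy h ↦ hxA (h ▸ hy)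
      by_cases h : ∃ y ∈ A ∩ B, ∃ u ∈ A \ B, x + y = u ∨ x + u = y ∨ y + u = x
      · obtain ⟨y, hy, u, hu, h⟩ := h
        exact ⟨y, hy, hne y (mem_inter.1 hy).1, u, hu, h⟩
      · exfalso
        push Not at h
        have hsplit : ∀ z ∈ insert x A, z = x ∨ z ∈ A ∩ B ∨ z ∈ A \ B := by
          intro z hz
          simp only [mem_insert, mem_inter, mem_sdiff] at hz ⊢
          tauto
        have hBx : ∀ z, z = x ∨ z ∈ A ∩ B → z ∈ B := by
          rintro z (rfl | hz)
          exacts [hxB, (mem_inter.1 hz).2]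
        have hUx : ∀ z, z = x ∨ z ∈ A \ B → z ∈ insert x (A \ B) := fun z hz ↦ mem_insert.2 hz
        have hAx : ∀ z, z ∈ A ∩ B ∨ z ∈ A \ B → z ∈ A := by
          rintro z (hz | hz)
          exacts [(mem_inter.1 hz).1, (mem_sdiff.1 hz).1]
        have h₁ := fun ha hb hab ↦ hsf a (hAx a ha) b (hAx b hb) (hAx _ hab)
        have h₂ := fun ha hb hab ↦ hB' a (hBx a ha) b (hBx b hb) (hBx _ hab)
        have h₃ := fun ha hb hab ↦ hxU a (hUx a ha) b (hUx b hb) (hUx _ hab)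
        have h₄ := h a
        have h₅ := h b
        have h₆ := h (a + b)
        have hab' := hsplit _ hab
        have ha' := hsplit a ha
        have hb' := hsplit b hb
        have hcomm := add_comm a b
        clear hsplit hBx hUx hAx h hxU hB' hsf hne hxA ha hb hab hB hA hx
        rcases ha' with ha | ha | ha <;> rcases hb' with hb | hb | hb <;>
          rcases hab' with hab | hab | hab <;> first
          | exact h₁ (by first | exact .inl ha | exact .inr ha) (by first | exact .inl hb | exact .inr hb)
              (by first | exact .inl hab | exact .inr hab)
          | exact h₂ (by first | exact .inl ha | exact .inr ha) (by first | exact .inl hb | exact .inr hb)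
              (by first | exact .inl hab | exact .inr hab)
          | exact h₃ (by first | exact .inl ha | exact .inr ha) (by first | exact .inl hb | exact .inr hb)
              (by first | exact .inl hab | exact .inr hab)
          | exact (h₄ ha b hb).2.2 hab
          | exact (h₅ hb a ha).2.2 (hcomm ▸ hab)
          | exact (h₅ hb _ hab).1 (by rw [ha])
          | exact (h₆ hab _ hb).2.1 (by rw [ha])
          | exact (h₄ ha _ hab).1 (by rw [hb, add_comm])
          | exact (h₆ hab _ ha).2.1 (by rw [hb, add_comm])
  · intro A hA A' hA' h
    simp only [coe_filter, Set.mem_ofPred_eq] at hA hA'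
    have h : A ∩ B = A' ∩ B := h
    rw [← sdiff_union_inter A B, ← sdiff_union_inter A' B, hA.2, hA'.2, h]

theorem card_filter_sdiff_eq_le_pow {B : Finset G} (hB : IsSumFree (B : Set G)) (U : Finset G)
    {c : ℝ} (hc₁ : 1 ≤ c) (hc : ∀ k : ℕ, (k : ℝ) ≤ c ^ k) :
    (#((maximalSumFree G).filter fun A ↦ A \ B = U) : ℝ) ≤ c ^ #(linkVertices B U) :=
  (Nat.cast_le.2 (card_filter_sdiff_eq_le hB U)).trans <|
    card_maximalIndep_le (fun _ _ h ↦ h.symm) hc₁ hc _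

end Link

section Stability

variable {G : Type*} [AddCommGroup G] [DecidableEq G] [Fintype G]

/-- A sum-free set of density more than `2 / 5` avoids a subgroup of index two. -/
theorem exists_index_two_of_two_fifths_lt {B : Finset G} (hB : IsSumFree (B : Set G))
    (hcard : 2 * Fintype.card G < 5 * #B) :
    ∃ H : AddSubgroup G, H.index = 2 ∧ ∀ x ∈ B, x ∉ H := by
  have hB' : ∀ a ∈ B, ∀ b ∈ B, a + b ∉ B := hB
  set D : Finset G := (B ×ˢ B).image fun p ↦ p.1 - p.2 with hD
  have hmemD : ∀ {p}, p ∈ D ↔ ∃ a ∈ B, ∃ b ∈ B, a - b = p := by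
    simp [hD, and_assoc]
  have hDB : Disjoint D B := by
    rw [disjoint_left]
    intro x hx hxB
    obtain ⟨a, ha, b, hb, rfl⟩ := hmemD.1 hx
    exact hB' (a - b) hxB b hb (by simpa using ha)
  have hDcard : #D + #B ≤ Fintype.card G := by
    rw [← card_union_of_disjoint hDB]
    exact card_le_univ _
  have hrep : ∀ p ∈ D, #B < 2 * #(B.filter fun d ↦ d + p ∈ B) := by
    intro p hp
    obtain ⟨a, ha, b, hb, rfl⟩ := hmemD.1 hp
    have h₁ : B.image (fun c ↦ a - c) ∪ B.image (fun d ↦ b - d) ⊆ D := by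
      intro x hx
      rcases mem_union.1 hx with hx | hx <;> obtain ⟨c, hc, rfl⟩ := mem_image.1 hx
      · exact hmemD.2 ⟨a, ha, c, hc, rfl⟩
      · exact hmemD.2 ⟨b, hb, c, hc, rfl⟩
    have h₂ : #(B.image (fun c ↦ a - c) ∩ B.image (fun d ↦ b - d)) ≤
        #(B.filter fun d ↦ d + (a - b) ∈ B) := by
      refine card_le_card_of_injOn (fun x ↦ b - x) ?_ ?_
      · intro x hx
        obtain ⟨hx₁, hx₂⟩ := mem_inter.1 hx
        obtain ⟨c, hc, rfl⟩ := mem_image.1 hx₁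
        obtain ⟨d, hd, hcd⟩ := mem_image.1 hx₂
        have hd' : b - (a - c) = d := by rw [← hcd]; abel
        refine mem_filter.2 ⟨by simpa [hd'] using hd, ?_⟩
        have : b - (a - c) + (a - b) = c := by abel
        simpa [this] using hc
      · exact fun x _ y _ h ↦ sub_right_injective h
    have h₃ := card_union_add_card_inter (B.image (fun c ↦ a - c)) (B.image (fun d ↦ b - d))
    rw [card_image_of_injective _ sub_right_injective,
      card_image_of_injective _ sub_right_injective] at h₃
    have h₄ := card_le_card h₁
    omega
  have hneg : ∀ p ∈ D, -p ∈ D := by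
    intro p hp
    obtain ⟨a, ha, b, hb, rfl⟩ := hmemD.1 hp
    exact hmemD.2 ⟨b, hb, a, ha, by abel⟩
  have hadd : ∀ p ∈ D, ∀ q ∈ D, p + q ∈ D := by
    intro p hp q hq
    have h₁ := hrep p hp
    have h₂ := hrep (-q) (hneg q hq)
    have h₃ := card_union_add_card_inter (B.filter fun d ↦ d + p ∈ B)
      (B.filter fun d ↦ d + -q ∈ B)
    have h₄ : #((B.filter fun d ↦ d + p ∈ B) ∪ (B.filter fun d ↦ d + -q ∈ B)) ≤ #B :=
      card_le_card (union_subset (filter_subset _ _) (filter_subset _ _))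
    obtain ⟨d, hd⟩ : ((B.filter fun d ↦ d + p ∈ B) ∩ (B.filter fun d ↦ d + -q ∈ B)).Nonempty := by
      rw [← card_pos]; omega
    simp only [mem_inter, mem_filter] at hd
    exact hmemD.2 ⟨d + p, hd.1.2, d + -q, hd.2.2, by abel⟩
  obtain ⟨b, hb⟩ : B.Nonempty := by rw [← card_pos]; omega
  let H : AddSubgroup G :=
    { carrier := D
      add_mem' := fun {p q} hp hq ↦ hadd p hp q hq
      zero_mem' := hmemD.2 ⟨b, hb, b, hb, sub_self b⟩
      neg_mem' := fun {p} hp ↦ hneg p hp }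
  have hH : ∀ x, x ∈ H ↔ x ∈ D := fun x ↦ Iff.rfl
  have hBH : ∀ x ∈ B, x ∉ H := fun x hx hxH ↦ disjoint_left.1 hDB hxH hx
  refine ⟨H, ?_, hBH⟩
  have hHcard : Nat.card H = #D := by
    exact (Nat.card_congr (Equiv.refl _)).trans (Nat.card_eq_finsetCard D)
  have hBD : #B ≤ #D := by
    refine card_le_card_of_injOn (fun x ↦ x - b) ?_ fun x _ y _ h ↦ sub_left_injective h
    exact fun x hx ↦ hmemD.2 ⟨x, hx, b, hb, rfl⟩
  have hmul := H.card_mul_index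
  rw [Nat.card_eq_fintype_card (α := G), hHcard] at hmul
  have h₁ : H.index ≠ 1 := fun h ↦ hBH b hb (by rw [AddSubgroup.index_eq_one.1 h]; trivial)
  have h₀ : H.index ≠ 0 := fun h ↦ by
    rw [h, mul_zero] at hmul
    exact Fintype.card_ne_zero hmul.symm
  have h₃ : H.index < 3 := by
    by_contra! h
    have := Nat.mul_le_mul_left (#D) h
    omega
  omega

end Stability

section Structure

variable {G : Type*} [AddCommGroup G] [DecidableEq G]

omit [DecidableEq G] in
/-- If every double of `G` is `0` or `w`, then `y` and `-y` have the same neighbours in a link graph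
whenever `y + y = w`. -/
lemma Link.neg_right {w : G} (hw : ∀ x : G, x + x = 0 ∨ x + x = w) {U : Finset G}
    (hwU : w ∉ U) (hU₀ : (0 : G) ∉ U) {x y : G} (hy : y + y = w) (h : Link U x y) :
    Link U x (-y) := by
  have hww : -w = w := by
    rcases hw w with h | h
    · exact neg_eq_of_add_eq_zero_left h
    · have : w = 0 := by simpa using h
      simp [this]
  obtain ⟨-, u, hu, h⟩ := h
  refine ⟨?_, ?_⟩
  · rintro rfl
    rcases h with rfl | h | h
    · exact hU₀ (by simpa using hu)
    · have : u = w := by rw [← hy, ← sub_eq_zero, ← sub_eq_zero.2 h]; abel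
      exact hwU (this ▸ hu)
    · have : u = -w := by rw [← hy, ← sub_eq_zero, ← sub_eq_zero.2 h]; abel
      exact hwU (hww ▸ this ▸ hu)
  · rcases h with h | h | h
    · exact ⟨u, hu, .inr (.inr (by rw [← h]; abel))⟩
    · have hyu : x = y - u := by rw [← h]; abel
      rcases hw u with hu' | hu'
      · refine ⟨u, hu, .inl ?_⟩
        have : u = -u := (neg_eq_of_add_eq_zero_left hu').symm
        rw [hyu, sub_eq_add_neg, ← this]
        abel
      · rcases hw x with hx | hx
        · refine ⟨u, hu, .inr (.inr ?_)⟩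
          have : x = -x := (neg_eq_of_add_eq_zero_left hx).symm
          rw [this, hyu]
          abel
        · refine ⟨u, hu, .inr (.inl ?_)⟩
          have : y + y = -(y + y) := by rw [hy, hww]
          have h₂ : x + u + (x + u) = y + y := by rw [h]
          have h₃ : x + u - -y = y + y := by rw [h]; abel
          have h₄ : y + y = 0 := by
            have : x + u + (x + u) = x + x + (u + u) := by abel
            rw [← h₂, this, hx, hu', ← neg_eq_iff_add_eq_zero, hww]
          rw [← sub_eq_zero, h₃, h₄]
    · exact ⟨u, hu, .inl (by rw [← h]; abel)⟩

/-- A set disjoint from its translate by one of its elements `z`, both lying in `K`, has at most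
half of the elements of `K`. -/
lemma two_mul_card_le_of_add_right {S K : Finset G} {z : G} (hS : S ⊆ K)
    (hz : ∀ x ∈ S, x + z ∈ K ∧ x + z ∉ S) : 2 * #S ≤ #K := by
  have h₁ : S.image (· + z) ⊆ K \ S := by
    intro y hy
    obtain ⟨x, hx, rfl⟩ := mem_image.1 hy
    exact mem_sdiff.2 (hz x hx)
  have h₂ := card_le_card h₁
  rw [card_image_of_injective _ (add_left_injective z), card_sdiff_of_subset hS] at h₂
  have := card_le_card hS
  omega

variable [Fintype G]

/-- In a group whose doubles are `0` or `w`, both cases occurring, few maximal sum-free sets have a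
prescribed trace on a subgroup of index two. -/
theorem card_filter_sdiff_compl_le {w z : G} (hw : ∀ x : G, x + x = 0 ∨ x + x = w) (hw₀ : w ≠ 0)
    (hz : z + z = w) {P : G → Prop} (hP : ∀ x, P x → x + x = w ∧ ¬ P (-x))
    (hP' : ∀ x, x + x = w → P x ∨ P (-x)) {H : AddSubgroup G} (hH : H.index = 2)
    {B : Finset G} (hB : ∀ x, x ∈ B ↔ x ∉ H) (U : Finset G)
    {c : ℝ} (hc₁ : 1 ≤ c) (hc : ∀ k : ℕ, (k : ℝ) ≤ c ^ k) :
    (#((maximalSumFree G).filter fun A ↦ A \ B = U) : ℝ) ≤ c ^ (2 * Fintype.card G / 5) := by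
  classical
  have hadd (a b : G) : a + b ∈ H ↔ (a ∈ H ↔ b ∈ H) := AddSubgroup.add_mem_iff_of_index_two hH
  have hBsf : IsSumFree (B : Set G) := by
    intro x hx y hy hxy
    simp only [mem_coe, hB, hadd] at hx hy hxy
    tauto
  rcases ((maximalSumFree G).filter fun A ↦ A \ B = U).eq_empty_or_nonempty with h | ⟨A, hA⟩
  · rw [h]
    simp only [card_empty, Nat.cast_zero]
    positivity
  simp only [mem_filter, mem_maximalSumFree] at hA
  obtain ⟨hA, hAU⟩ := hA
  have hUA : ∀ u ∈ U, u ∈ A := fun u hu ↦ (mem_sdiff.1 (hAU ▸ hu)).1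
  have hUH : ∀ u ∈ U, u ∈ H := fun u hu ↦ by
    have := (mem_sdiff.1 (hAU ▸ hu)).2
    rwa [hB, not_not] at this
  have hUsf : ∀ a ∈ U, ∀ b ∈ U, a + b ∉ U :=
    fun a ha b hb hab ↦ hA.1 a (hUA a ha) b (hUA b hb) (hUA _ hab)
  have hU₀ : (0 : G) ∉ U := fun h ↦ hUsf 0 h 0 h (by simpa using h)
  set E : Finset G := B.filter fun x ↦ x + x = 0 with hE
  set W : Finset G := B.filter fun x ↦ x + x = w with hW
  set Q : Finset G := W.filter fun x ↦ ¬ P x with hQ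
  have hEW : #E + #W ≤ #B := by
    rw [← card_union_of_disjoint]
    · exact card_le_card (union_subset (filter_subset _ _) (filter_subset _ _))
    · rw [disjoint_left]
      intro x hx hx'
      exact hw₀ ((mem_filter.1 hx').2.symm.trans (mem_filter.1 hx).2)
  have hK : 2 * #(univ.filter fun x : G ↦ x + x = 0) ≤ Fintype.card G := by
    refine two_mul_card_le_of_add_right (z := z) (subset_univ _) fun x hx ↦ ⟨mem_univ _, ?_⟩
    simp only [mem_filter, mem_univ, true_and] at hx ⊢
    rwa [add_add_add_comm, hx, hz, zero_add]
  have hEK : 2 * #E ≤ #(univ.filter fun x : G ↦ x + x = 0) := by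
    rcases E.eq_empty_or_nonempty with h | ⟨e, he⟩
    · simp [h]
    · refine two_mul_card_le_of_add_right (z := e) (filter_subset_filter _ (subset_univ _))
        fun x hx ↦ ?_
      simp only [hE, mem_filter, hB, mem_univ, true_and] at hx he ⊢
      refine ⟨by rw [add_add_add_comm, hx.2, he.2, zero_add], fun h ↦ h.1 ?_⟩
      rw [hadd]
      tauto
  have hBcard : 2 * #B ≤ Fintype.card G := by
    rcases B.eq_empty_or_nonempty with h | ⟨e, he⟩
    · simp [h]
    · exact two_mul_card_le_of_add_right (z := e) (subset_univ _)
        fun x hx ↦ ⟨mem_univ _, hBsf x hx e he⟩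
  by_cases hwU : w ∈ U
  · refine (card_filter_sdiff_eq_le_pow hBsf U hc₁ hc).trans (pow_le_pow_right₀ hc₁ ?_)
    have : linkVertices B U ⊆ E := by
      intro x hx
      obtain ⟨hxB, hx⟩ := mem_linkVertices.1 hx
      refine mem_filter.2 ⟨hxB, (hw x).resolve_right fun h ↦ ?_⟩
      exact hx x (mem_insert_self _ _) x (mem_insert_self _ _) (h ▸ mem_insert_of_mem hwU)
    have := card_le_card this
    omega
  have hww : -w = w := by
    rcases hw w with h | h
    · exact neg_eq_of_add_eq_zero_left h
    · exact absurd (by simpa using h) hw₀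
  have hWneg : ∀ x : G, x + x = w → -x + -x = w := fun x hx ↦ by rw [← neg_add, hx, hww]
  have hQW : 2 * #Q ≤ #W := by
    have h₁ : Q.image (- ·) ⊆ W \ Q := by
      intro y hy
      obtain ⟨x, hx, rfl⟩ := mem_image.1 hy
      simp only [hQ, hW, mem_filter, hB, mem_sdiff, neg_mem_iff] at hx ⊢
      obtain ⟨⟨hxH, hxw⟩, hxP⟩ := hx
      have := (hP' x hxw).resolve_left hxP
      exact ⟨⟨hxH, hWneg x hxw⟩, fun h ↦ h.2 this⟩
    have h₂ := card_le_card h₁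
    have hQW : Q ⊆ W := filter_subset _ _
    rw [card_image_of_injective _ neg_injective, card_sdiff_of_subset hQW] at h₂
    have := card_le_card hQW
    omega
  set V := linkVertices B U with hV
  have hnegV : ∀ y ∈ V, y + y = w → -y ∈ V := by
    intro y hy hyw
    obtain ⟨hyB, hy⟩ := mem_linkVertices.1 hy
    rw [hB] at hyB
    have hyH : -y ∉ H := by rwa [neg_mem_iff]
    refine mem_linkVertices.2 ⟨by rwa [hB], ?_⟩
    have hU' : ∀ u ∈ U, -y + u ∉ insert (-y) U := by
      intro u hu h
      rcases mem_insert.1 h with h | h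
      · exact hU₀ ((by simpa using h : u = 0) ▸ hu)
      · have := hUH _ h
        rw [hadd] at this
        exact hyH (this.2 (hUH u hu))
    intro a ha b hb
    rcases mem_insert.1 ha with rfl | ha <;> rcases mem_insert.1 hb with rfl | hb
    · rw [hWneg y hyw, mem_insert, not_or]
      refine ⟨fun h ↦ hyH (h ▸ ?_), hwU⟩
      rw [← hyw, hadd]
    · exact hU' b hb
    · rw [add_comm]
      exact hU' a ha
    · rw [mem_insert, not_or]
      refine ⟨fun h ↦ hyH (h ▸ ?_), hUsf a ha b hb⟩
      rw [hadd]
      exact iff_of_true (hUH a ha) (hUH b hb)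
  set V' := V.filter fun x ↦ ¬ P x with hV'
  have hV'card : #V' ≤ #E + #Q := by
    refine (card_le_card ?_).trans (card_union_le _ _)
    intro x hx
    obtain ⟨hxV, hxP⟩ := mem_filter.1 hx
    have hxB := linkVertices_subset hxV
    simp only [mem_union, hE, hQ, hW, mem_filter]
    have := hw x
    tauto
  have htwin : #(maximalIndep (Link U) V) ≤ #(maximalIndep (Link U) V') := by
    refine card_maximalIndep_le_of_twins (fun _ _ h ↦ h.symm) (filter_subset _ _) fun y hy hyV' ↦ ?_
    have hyP : P y := by simpa [hV', hy] using hyV'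
    obtain ⟨hyw, hyP'⟩ := hP y hyP
    refine ⟨-y, mem_filter.2 ⟨hnegV y hy hyw, hyP'⟩, fun x _ ↦
      ⟨Link.neg_right hw hwU hU₀ hyw, fun h ↦ ?_⟩⟩
    simpa using Link.neg_right hw hwU hU₀ (hWneg y hyw) h
  calc (#((maximalSumFree G).filter fun A ↦ A \ B = U) : ℝ)
      ≤ #(maximalIndep (Link U) V') := by
        exact_mod_cast (card_filter_sdiff_eq_le hBsf U).trans htwin
    _ ≤ c ^ #V' := card_maximalIndep_le (fun _ _ h ↦ h.symm) hc₁ hc _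
    _ ≤ c ^ (2 * Fintype.card G / 5) := pow_le_pow_right₀ hc₁ (by omega)

/-- Every sum-free subset of `(ℤ/2ℤ)^t × ℤ/4ℤ` is contained in a sum-free set outside of which few
maximal sum-free sets have a prescribed trace. -/
theorem exists_superset_card_filter_sdiff_le {t : ℕ} {B : Finset ((Fin t → ZMod 2) × ZMod 4)}
    (hB : IsSumFree (B : Set ((Fin t → ZMod 2) × ZMod 4)))
    {c : ℝ} (hc₁ : 1 ≤ c) (hc : ∀ k : ℕ, (k : ℝ) ≤ c ^ k) :
    ∃ B', B ⊆ B' ∧ ∀ U,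
      (#((maximalSumFree ((Fin t → ZMod 2) × ZMod 4)).filter fun A ↦ A \ B' = U) : ℝ) ≤
        c ^ (2 * Fintype.card ((Fin t → ZMod 2) × ZMod 4) / 5) := by
  classical
  by_cases hcard : 2 * Fintype.card ((Fin t → ZMod 2) × ZMod 4) < 5 * #B
  · obtain ⟨H, hH, hBH⟩ := exists_index_two_of_two_fifths_lt hB hcard
    have hdouble (v : Fin t → ZMod 2) : v + v = 0 := by
      funext i
      exact CharTwo.add_self_eq_zero _
    refine ⟨univ.filter (· ∉ H), fun x hx ↦ by simpa using hBH x hx, fun U ↦ ?_⟩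
    refine card_filter_sdiff_compl_le (w := (0, 2)) (z := (0, 1)) (P := fun x ↦ x.2 = 3)
      ?_ ?_ ?_ ?_ ?_ hH (by simp) U hc₁ hc
    · rintro ⟨v, a⟩
      simp only [Prod.mk_add_mk, hdouble, Prod.mk_eq_zero, Prod.mk.injEq, true_and]
      revert a; decide
    · simp only [ne_eq, Prod.mk_eq_zero, true_and]
      decide
    · simp only [Prod.mk_add_mk, add_zero, Prod.mk.injEq, true_and]
      decide
    · rintro ⟨v, a⟩
      simp only [Prod.mk_add_mk, hdouble, Prod.mk.injEq, true_and, Prod.neg_mk]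
      revert a; decide
    · rintro ⟨v, a⟩
      simp only [Prod.mk_add_mk, hdouble, Prod.mk.injEq, true_and, Prod.neg_mk]
      revert a; decide
  · refine ⟨B, Subset.rfl, fun U ↦ (card_filter_sdiff_eq_le_pow hB U hc₁ hc).trans
      (pow_le_pow_right₀ hc₁ ?_)⟩
    have := card_le_card (linkVertices_subset (B := B) (U := U))
    omega

end Structure

section Removal

variable {G : Type*} [AddCommGroup G] [DecidableEq G]

/-- The solutions of `x + y = z` in `F`, represented by `(x, y)`. -/
def schurPairs (F : Finset G) : Finset (G × G) :=
  (F ×ˢ F).filter fun p ↦ p.1 + p.2 ∈ F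

lemma mem_schurPairs {F : Finset G} {p : G × G} :
    p ∈ schurPairs F ↔ p.1 ∈ F ∧ p.2 ∈ F ∧ p.1 + p.2 ∈ F := by
  simp [schurPairs, and_assoc]

variable [Fintype G]

open SimpleGraph TripartiteFromTriangles in
/-- A family of solutions of `x + y = z` in `F`, no two of which share a coordinate, forces many
solutions. -/
lemma le_card_schurPairs_of_injOn {F : Finset G} {M : Finset (G × G)} (hM : M ⊆ schurPairs F)
    (h₁ : Set.InjOn (fun p : G × G ↦ p.1) M) (h₂ : Set.InjOn (fun p : G × G ↦ p.2) M)
    (h₃ : Set.InjOn (fun p : G × G ↦ p.1 + p.2) M) {ε : ℝ}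
    (hε : ε * Fintype.card G ≤ #M) :
    triangleRemovalBound (ε / 9) * Fintype.card G ^ 2 ≤ #(schurPairs F) := by
  set n := Fintype.card G with hn
  have hn₀ : (0 : ℝ) < n := by exact_mod_cast Fintype.card_pos
  let f : G × G × G → G × G × G := fun q ↦ (q.1, q.1 + q.2.1, q.1 + q.2.1 + q.2.2)
  have hf : Function.Injective f := by
    rintro ⟨a, x, y⟩ ⟨b, x', y'⟩ h
    simp only [f, Prod.mk.injEq] at h
    obtain ⟨rfl, h, h'⟩ := h
    obtain rfl := add_left_cancel h
    obtain rfl := add_left_cancel h'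
    rfl
  let t : Finset (G × G × G) := ((univ : Finset G) ×ˢ M).image f
  have ht : ∀ {a b c}, (a, b, c) ∈ t ↔ (b - a, c - b) ∈ M := by
    intro a b c
    simp only [t, f, mem_image, mem_product, mem_univ, true_and, Prod.exists, Prod.mk.injEq]
    constructor
    · rintro ⟨a, x, y, h, rfl, rfl, rfl⟩
      simpa using h
    · exact fun h ↦ ⟨a, b - a, c - b, h, rfl, by abel, by abel⟩
  have htcard : #t = n * #M := by
    rw [card_image_of_injective _ hf, card_product, card_univ]
  have : ExplicitDisjoint t :=
    { inj₀ := fun a b c a' h h' ↦ by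
        simpa using congrArg Prod.fst (h₂ (ht.1 h) (ht.1 h') rfl)
      inj₁ := fun a b c b' h h' ↦ by
        simpa using congrArg Prod.fst (h₃ (ht.1 h) (ht.1 h') (by simp))
      inj₂ := fun a b c c' h h' ↦ by
        simpa using congrArg Prod.snd (h₁ (ht.1 h) (ht.1 h') rfl) }
  have hfar : (graph t).FarFromTriangleFree (ε / 9) := by
    refine farFromTriangleFree t ?_
    rw [htcard]
    push_cast
    rw [← hn]
    nlinarith
  have hle := hfar.le_card_cliqueFinset
  have hup : #((graph t).cliqueFinset 3) ≤ n * #(schurPairs F) := by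
    rw [hn, ← card_univ, ← card_product]
    refine (card_le_card ?_).trans
      (card_image_le (f := fun q : G × G × G ↦ toTriangle (f q)))
    intro s hs
    rw [mem_cliqueFinset_iff, SimpleGraph.is3Clique_iff] at hs
    obtain ⟨x, y, z, hxy, hxz, hyz, rfl⟩ := hs
    obtain ⟨a, b, c, habc, hab, hac, hbc⟩ := graph_triple hxy hxz hyz
    rw [Graph.in₀₁_iff] at hab
    rw [Graph.in₀₂_iff] at hac
    rw [Graph.in₁₂_iff] at hbc
    obtain ⟨_, hab⟩ := hab
    obtain ⟨_, hac⟩ := hac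
    obtain ⟨_, hbc⟩ := hbc
    have hab := mem_schurPairs.1 (hM (ht.1 hab))
    have hac := mem_schurPairs.1 (hM (ht.1 hac))
    have hbc := mem_schurPairs.1 (hM (ht.1 hbc))
    refine mem_image.2 ⟨(a, b - a, c - b), mem_product.2 ⟨mem_univ _, mem_schurPairs.2
      ⟨hab.1, hbc.2.1, ?_⟩⟩, ?_⟩
    · simpa using hac.2.2
    · rw [← habc]
      simp [f]
  have hup' : (#((graph t).cliqueFinset 3) : ℝ) ≤ n * #(schurPairs F) := by exact_mod_cast hup
  have hcard : (Fintype.card (G ⊕ G ⊕ G) : ℝ) = 3 * n := by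
    simp only [Fintype.card_sum, ← hn]
    push_cast
    ring
  rw [hcard] at hle
  have hfinal : n * (27 * (triangleRemovalBound (ε / 9) * n ^ 2)) ≤ n * (#(schurPairs F) : ℝ) := by
    calc _ = triangleRemovalBound (ε / 9) * (3 * n) ^ 3 := by ring
      _ ≤ _ := hle.trans hup'
  have hfinal := le_of_mul_le_mul_left hfinal hn₀
  rcases le_or_gt 0 (triangleRemovalBound (ε / 9) * (n : ℝ) ^ 2) with h | h
  · linarith
  · exact h.le.trans (Nat.cast_nonneg _)

/-- **Green's removal lemma** for the equation `x + y = z`. -/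
theorem exists_isSumFree_subset_of_card_schurPairs_lt {ε : ℝ} {F : Finset G}
    (hF : #(schurPairs F) < SimpleGraph.triangleRemovalBound (ε / 27) * Fintype.card G ^ 2) :
    ∃ B ⊆ F, IsSumFree (B : Set G) ∧ (#(F \ B) : ℝ) ≤ ε * Fintype.card G := by
  classical
  obtain ⟨M, hM, hmax⟩ := ((schurPairs F).powerset.filter fun M : Finset (G × G) ↦
    Set.InjOn (fun p : G × G ↦ p.1) M ∧ Set.InjOn (fun p : G × G ↦ p.2) M ∧
      Set.InjOn (fun p : G × G ↦ p.1 + p.2) M).exists_max_image card ⟨∅, by simp⟩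
  simp only [mem_filter, mem_powerset] at hM hmax
  obtain ⟨hMF, h₁, h₂, h₃⟩ := hM
  set R : Finset G := M.image (fun p ↦ p.1) ∪ (M.image (fun p ↦ p.2) ∪
    M.image (fun p ↦ p.1 + p.2)) with hR
  have hRcard : #R ≤ 3 * #M := by
    have e₁ := card_union_le (M.image (fun p ↦ p.1)) (M.image (fun p ↦ p.2) ∪
      M.image (fun p ↦ p.1 + p.2))
    have e₂ := card_union_le (M.image (fun p ↦ p.2)) (M.image (fun p ↦ p.1 + p.2))
    have e₃ := card_image_le (s := M) (f := fun p ↦ p.1)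
    have e₄ := card_image_le (s := M) (f := fun p ↦ p.2)
    have e₅ := card_image_le (s := M) (f := fun p ↦ p.1 + p.2)
    rw [hR]
    omega
  have hMcard : (#M : ℝ) < ε / 3 * Fintype.card G := by
    by_contra! h
    have := le_card_schurPairs_of_injOn hMF h₁ h₂ h₃ h
    rw [div_div] at this
    norm_num at this
    linarith
  refine ⟨F \ R, sdiff_subset, ?_, ?_⟩
  · intro x hx y hy hxy
    simp only [mem_coe, mem_sdiff] at hx hy hxy
    have hx' : ∀ p ∈ M, p.1 ≠ x := fun p hp h ↦
      hx.2 (mem_union_left _ (mem_image.2 ⟨p, hp, h⟩))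
    have hy' : ∀ p ∈ M, p.2 ≠ y := fun p hp h ↦
      hy.2 (mem_union_right _ (mem_union_left _ (mem_image.2 ⟨p, hp, h⟩)))
    have hxy' : ∀ p ∈ M, p.1 + p.2 ≠ x + y := fun p hp h ↦
      hxy.2 (mem_union_right _ (mem_union_right _ (mem_image.2 ⟨p, hp, h⟩)))
    have hnot : (x, y) ∉ M := fun h ↦ hx' _ h rfl
    have hnot' : (x, y) ∉ (M : Set (G × G)) := by exact_mod_cast hnot
    have := hmax (insert (x, y) M) ⟨insert_subset (mem_schurPairs.2 ⟨hx.1, hy.1, hxy.1⟩) hMF, ?_⟩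
    · rw [card_insert_of_notMem hnot] at this
      omega
    · rw [coe_insert, Set.injOn_insert hnot', Set.injOn_insert hnot', Set.injOn_insert hnot']
      refine ⟨⟨h₁, ?_⟩, ⟨h₂, ?_⟩, ⟨h₃, ?_⟩⟩ <;> rintro ⟨p, hp, h⟩
      exacts [hx' p hp h, hy' p hp h, hxy' p hp h]
  · have : #(F \ (F \ R)) ≤ #R := card_le_card fun x hx ↦ by
      simp only [mem_sdiff, not_and, not_not] at hx
      exact hx.2 hx.1
    have : (#(F \ (F \ R)) : ℝ) ≤ 3 * #M := by exact_mod_cast this.trans hRcard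
    linarith

end Removal

section Container

lemma card_filter_card_le_le {α : Type*} [Fintype α] [DecidableEq α] (m : ℕ) :
    #(univ.filter fun S : Finset α ↦ #S ≤ m) ≤ (Fintype.card α + 1) ^ m := by
  induction m with
  | zero =>
    have : (univ.filter fun S : Finset α ↦ #S ≤ 0) ⊆ {∅} := fun S hS ↦ by simpa using hS
    simpa using card_le_card this
  | succ m ih =>
    have : (univ.filter fun S : Finset α ↦ #S ≤ m + 1) ⊆
        ((univ : Finset (Option α)) ×ˢ univ.filter fun S : Finset α ↦ #S ≤ m).image
          fun p ↦ p.1.elim p.2 (insert · p.2) := by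
      intro S hS
      simp only [mem_filter, mem_univ, true_and] at hS
      simp only [mem_image, mem_product, mem_filter, mem_univ, true_and, Prod.exists]
      rcases S.eq_empty_or_nonempty with rfl | ⟨a, ha⟩
      · exact ⟨none, ∅, by simp⟩
      · refine ⟨some a, S.erase a, ?_, insert_erase ha⟩
        rw [card_erase_of_mem ha]
        omega
    refine (card_le_card this).trans (card_image_le.trans ?_)
    rw [card_product, card_univ, Fintype.card_option, pow_succ, mul_comm]
    exact Nat.mul_le_mul_right _ ih

variable {G : Type*} [AddCommGroup G] [DecidableEq G]

/-- The sums of elements of `T` and `S` that lie in `F`. -/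
def sumsIn (F S T : Finset G) : Finset G :=
  F.filter fun y ↦ ∃ t ∈ T, ∃ s ∈ S, t + s = y

/-- The elements of `S` whose sum with `v` lies in `F` but not among the sums from `T` and `S`. -/
def newShifts (F S T : Finset G) (v : G) : Finset G :=
  S.filter fun s ↦ v + s ∈ F ∧ v + s ∉ sumsIn F S T

lemma card_schurPairs (F : Finset G) :
    #(schurPairs F) = ∑ s ∈ F, #(F.filter fun v ↦ v + s ∈ F) := by
  rw [schurPairs, card_filter, sum_product_right]
  simp_rw [card_filter]

/-- Every subset `A` of `F` has a small subset `T` such that no element of `A` has many new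
shifts. -/
lemma exists_fingerprint (F S A : Finset G) {φ : ℝ} (hφ : 0 < φ) :
    ∃ T ⊆ A, #T * φ ≤ #F ∧ ∀ v ∈ A, #(newShifts F S T v) < φ := by
  classical
  obtain ⟨T, hT, hmax⟩ := (A.powerset.filter fun T ↦ #T * φ ≤ #(sumsIn F S T)).exists_max_image
    card ⟨∅, by simp⟩
  simp only [mem_filter, mem_powerset] at hT hmax
  refine ⟨T, hT.1, hT.2.trans (by exact_mod_cast card_le_card (filter_subset _ _)), ?_⟩
  intro v hv
  by_contra! h
  have hvT : v ∉ T := by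
    intro hvT
    have : newShifts F S T v = ∅ := by
      refine filter_eq_empty_iff.2 fun s hs h ↦ h.2 ?_
      exact mem_filter.2 ⟨h.1, v, hvT, s, hs, rfl⟩
    rw [this, card_empty, Nat.cast_zero] at h
    linarith
  have hsub : sumsIn F S T ∪ (newShifts F S T v).image (v + ·) ⊆ sumsIn F S (insert v T) := by
    intro y hy
    rcases mem_union.1 hy with hy | hy
    · obtain ⟨hyF, t, ht, s, hs, hts⟩ := mem_filter.1 hy
      exact mem_filter.2 ⟨hyF, t, mem_insert_of_mem ht, s, hs, hts⟩
    · obtain ⟨s, hs, rfl⟩ := mem_image.1 hy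
      obtain ⟨hs, hsF, -⟩ := mem_filter.1 hs
      exact mem_filter.2 ⟨hsF, v, mem_insert_self _ _, s, hs, rfl⟩
  have hdisj : Disjoint (sumsIn F S T) ((newShifts F S T v).image (v + ·)) := by
    rw [disjoint_right]
    intro y hy
    obtain ⟨s, hs, rfl⟩ := mem_image.1 hy
    exact (mem_filter.1 hs).2.2
  have hcard := card_le_card hsub
  rw [card_union_of_disjoint hdisj, card_image_of_injective _ (add_right_injective v)] at hcard
  have hcard : (#(sumsIn F S T) : ℝ) + #(newShifts F S T v) ≤ #(sumsIn F S (insert v T)) := by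
    exact_mod_cast hcard
  have := hmax (insert v T) ⟨insert_subset hv hT.1, ?_⟩
  · rw [card_insert_of_notMem hvT] at this
    omega
  · rw [card_insert_of_notMem hvT]
    push_cast
    linarith [hT.2]

variable [Fintype G]

open scoped Classical in
/-- The elements of `F` with few new shifts that are not themselves sums from `T` and `S`. -/
noncomputable def shrink (F S T : Finset G) (φ : ℝ) : Finset G :=
  (F.filter fun v ↦ #(newShifts F S T v) < φ) \ sumsIn F S T

omit [Fintype G] in
lemma card_shrink_le (F S T : Finset G) {φ d : ℝ} (hφ : 0 ≤ φ)
    (hS : ∀ s ∈ S, d ≤ #(F.filter fun v ↦ v + s ∈ F)) :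
    2 * #S * #(shrink F S T φ) + #S * d ≤ 2 * #S * #F + #F * φ := by
  classical
  set D := F.filter fun v ↦ #(newShifts F S T v) < φ with hD
  set N := sumsIn F S T with hN
  have hDF : D ⊆ F := filter_subset _ _
  have hNF : N ⊆ F := filter_subset _ _
  have h₁ : #(shrink F S T φ) ≤ #D := by
    rw [shrink, ← hD]
    exact card_le_card sdiff_subset
  have h₂ : #(shrink F S T φ) + #N ≤ #F := by
    have : #(shrink F S T φ) ≤ #(F \ N) := by
      rw [shrink, ← hD]
      exact card_le_card (sdiff_subset_sdiff hDF Subset.rfl)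
    rw [card_sdiff_of_subset hNF] at this
    have := card_le_card hNF
    omega
  have h₃ : #S * d ≤ ∑ v ∈ F, (#(S.filter fun s ↦ v + s ∈ F) : ℝ) := by
    have : ∑ v ∈ F, #(S.filter fun s ↦ v + s ∈ F) = ∑ s ∈ S, #(F.filter fun v ↦ v + s ∈ F) := by
      simp_rw [card_filter]
      exact sum_comm
    rw [← Nat.cast_sum, this, Nat.cast_sum, ← nsmul_eq_mul]
    exact card_nsmul_le_sum _ _ _ hS
  have h₄ : ∑ v ∈ F, (#(S.filter fun s ↦ v + s ∈ N) : ℝ) ≤ #S * #N := by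
    have : ∑ v ∈ F, #(S.filter fun s ↦ v + s ∈ N) = ∑ s ∈ S, #(F.filter fun v ↦ v + s ∈ N) := by
      simp_rw [card_filter]
      exact sum_comm
    rw [← Nat.cast_sum, this, Nat.cast_sum, ← nsmul_eq_mul]
    refine sum_le_card_nsmul _ _ _ fun s _ ↦ ?_
    refine Nat.cast_le.2 (card_le_card_of_injOn (· + s) ?_ fun x _ y _ h ↦ add_left_injective s h)
    exact fun v hv ↦ (mem_filter.1 hv).2
  have h₅ : ∀ v ∈ F, (#(S.filter fun s ↦ v + s ∈ F) : ℝ) ≤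
      (if v ∈ D then 0 else (#S : ℝ)) + φ + #(S.filter fun s ↦ v + s ∈ N) := by
    intro v hv
    split_ifs with hvD
    · have : #(S.filter fun s ↦ v + s ∈ F) ≤
          #(newShifts F S T v) + #(S.filter fun s ↦ v + s ∈ N) := by
        refine (card_le_card fun s hs ↦ ?_).trans (card_union_le _ _)
        simp only [newShifts, mem_union, mem_filter] at hs ⊢
        tauto
      have : (#(S.filter fun s ↦ v + s ∈ F) : ℝ) ≤
          #(newShifts F S T v) + #(S.filter fun s ↦ v + s ∈ N) := by exact_mod_cast this
      have := (mem_filter.1 hvD).2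
      linarith
    · have : (#(S.filter fun s ↦ v + s ∈ F) : ℝ) ≤ #S := by
        exact_mod_cast card_filter_le _ _
      have : (0 : ℝ) ≤ #(S.filter fun s ↦ v + s ∈ N) := Nat.cast_nonneg _
      linarith
  have h₆ := h₃.trans (sum_le_sum h₅)
  rw [sum_add_distrib, sum_add_distrib, sum_const, nsmul_eq_mul] at h₆
  have h₇ : ∑ v ∈ F, (if v ∈ D then 0 else (#S : ℝ)) = #S * (#F - #D) := by
    rw [sum_ite, sum_const_zero, zero_add, sum_const, nsmul_eq_mul, mul_comm,
      filter_not, filter_mem_eq_inter, inter_eq_right.2 hDF, cast_card_sdiff hDF]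
  rw [h₇] at h₆
  have h₁' : (#(shrink F S T φ) : ℝ) ≤ #D := by exact_mod_cast h₁
  have h₂' : (#(shrink F S T φ) : ℝ) + #N ≤ #F := by exact_mod_cast h₂
  have hS₀ : (0 : ℝ) ≤ #S := Nat.cast_nonneg _
  nlinarith [mul_le_mul_of_nonneg_left h₁' hS₀, mul_le_mul_of_nonneg_left h₂' hS₀]

/-- One step of the container algorithm. -/
lemma exists_shrinking_family {F : Finset G} {δ : ℝ} (hδ : 0 < δ) {m : ℕ}
    (hm : 4 * Fintype.card G ≤ δ * m ^ 2) (hm' : 8 * m ≤ δ * Fintype.card G)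
    (hF : δ * Fintype.card G ^ 2 ≤ #(schurPairs F)) :
    ∃ 𝓝 : Finset (Finset G), #𝓝 ≤ 2 * (Fintype.card G + 1) ^ (2 * m) ∧
      ∀ A ⊆ F, IsSumFree (A : Set G) →
        ∃ F' ∈ 𝓝, A ⊆ F' ∧ #F' + δ * Fintype.card G / 8 ≤ #F := by
  classical
  set n := Fintype.card G with hn
  have hn₀ : (0 : ℝ) < n := by exact_mod_cast Fintype.card_pos
  have hm₀ : (0 : ℝ) < m := by
    refine lt_of_le_of_ne (Nat.cast_nonneg _) fun h ↦ ?_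
    rw [← h] at hm
    norm_num at hm
    linarith
  have hFn : (#F : ℝ) ≤ n := by exact_mod_cast card_le_univ F
  let small : Finset (Finset G) := univ.filter fun S ↦ #S ≤ m
  have hsmall : #small ≤ (n + 1) ^ m := card_filter_card_le_le m
  have mem_small : ∀ {S}, S ∈ small ↔ #S ≤ m := by simp [small]
  set P := F.filter fun s ↦ δ * n / 2 ≤ #(F.filter fun v ↦ v + s ∈ F) with hP
  have hPF : P ⊆ F := filter_subset _ _
  have hPcard : δ * n / 2 ≤ #P := by
    have h₁ : (#(schurPairs F) : ℝ) ≤ ∑ s ∈ F, ((if s ∈ P then (n : ℝ) else 0) + δ * n / 2) := by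
      rw [card_schurPairs, Nat.cast_sum]
      refine sum_le_sum fun s hs ↦ ?_
      split_ifs with hsP
      · have : (#(F.filter fun v ↦ v + s ∈ F) : ℝ) ≤ n := by exact_mod_cast card_le_univ _
        have : 0 ≤ δ * n / 2 := by positivity
        linarith
      · have : ¬ δ * n / 2 ≤ #(F.filter fun v ↦ v + s ∈ F) := fun h ↦ hsP (mem_filter.2 ⟨hs, h⟩)
        linarith
    rw [sum_add_distrib, sum_ite_mem, inter_eq_right.2 hPF, sum_const, sum_const, nsmul_eq_mul,
      nsmul_eq_mul] at h₁
    have h₂ : #F * (δ * n / 2) ≤ n * (δ * n / 2) := by gcongr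
    have h₃ : n * (δ * n / 2) ≤ n * #P := by nlinarith
    exact le_of_mul_le_mul_left h₃ hn₀
  refine ⟨small.image (fun S ↦ F \ P ∪ S) ∪
    (small ×ˢ small).image fun p ↦ shrink F p.1 p.2 (δ * m / 4), ?_, ?_⟩
  · have e₁ : #(small.image fun S ↦ F \ P ∪ S) ≤ (n + 1) ^ (2 * m) :=
      (card_image_le.trans hsmall).trans (Nat.pow_le_pow_right (by omega) (by omega))
    have e₂ : #((small ×ˢ small).image fun p ↦ shrink F p.1 p.2 (δ * m / 4)) ≤
        (n + 1) ^ (2 * m) := by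
      refine card_image_le.trans ?_
      rw [card_product, two_mul, pow_add]
      exact Nat.mul_le_mul hsmall hsmall
    have := card_union_le (small.image fun S ↦ F \ P ∪ S)
      ((small ×ˢ small).image fun p ↦ shrink F p.1 p.2 (δ * m / 4))
    omega
  · intro A hAF hA
    rcases le_total #(A ∩ P) m with hAP | hAP
    · refine ⟨F \ P ∪ (A ∩ P), mem_union_left _ (mem_image_of_mem _ (mem_small.2 hAP)), ?_, ?_⟩
      · intro x hx
        have := hAF hx
        simp only [mem_union, mem_sdiff, mem_inter]
        tauto
      · have h₁ := card_union_le (F \ P) (A ∩ P)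
        have h₁ : (#(F \ P ∪ (A ∩ P)) : ℝ) ≤ #(F \ P) + #(A ∩ P) := by exact_mod_cast h₁
        rw [cast_card_sdiff hPF] at h₁
        have h₂ : (#(A ∩ P) : ℝ) ≤ m := by exact_mod_cast hAP
        have : 0 < δ * n := by positivity
        linarith
    · obtain ⟨S, hS, hSm⟩ := exists_subset_card_eq hAP
      obtain ⟨T, hT, hTcard, hTA⟩ := exists_fingerprint F S A (φ := δ * m / 4) (by positivity)
      have hTm : #T ≤ m := by
        have h₁ : (#T : ℝ) * (δ * m / 4) ≤ m * (δ * m / 4) := by nlinarith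
        exact_mod_cast le_of_mul_le_mul_right h₁ (by positivity)
      refine ⟨shrink F S T (δ * m / 4), mem_union_right _ (mem_image.2 ⟨(S, T), mem_product.2
        ⟨mem_small.2 hSm.le, mem_small.2 hTm⟩, rfl⟩), ?_, ?_⟩
      · intro v hv
        refine mem_sdiff.2 ⟨mem_filter.2 ⟨hAF hv, hTA v hv⟩, fun h ↦ ?_⟩
        obtain ⟨-, t, ht, s, hs, rfl⟩ := mem_filter.1 h
        exact hA t (hT ht) s (mem_inter.1 (hS hs)).1 hv
      · have h₁ := card_shrink_le F S T (φ := δ * m / 4) (d := δ * n / 2) (by positivity)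
          fun s hs ↦ (mem_filter.1 (mem_inter.1 (hS hs)).2).2
        rw [hSm] at h₁
        have h₂ : #F * (δ * m / 4) ≤ n * (δ * m / 4) := by gcongr
        have h₃ : 2 * m * (#(shrink F S T (δ * m / 4)) + δ * n / 8) ≤ 2 * m * #F := by nlinarith
        exact le_of_mul_le_mul_left h₃ (by positivity)

/-- **Container lemma**: few sets with few solutions of `x + y = z` cover all sum-free sets. -/
theorem exists_containers {δ : ℝ} (hδ : 0 < δ) {m : ℕ}
    (hm : 4 * Fintype.card G ≤ δ * m ^ 2) (hm' : 8 * m ≤ δ * Fintype.card G) {K : ℕ}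
    (hK : 8 < δ * K) :
    ∃ 𝓕 : Finset (Finset G), #𝓕 ≤ (2 * (Fintype.card G + 1) ^ (2 * m)) ^ K ∧
      ∀ A : Finset G, IsSumFree (A : Set G) →
        ∃ F ∈ 𝓕, A ⊆ F ∧ #(schurPairs F) < δ * Fintype.card G ^ 2 := by
  classical
  set n := Fintype.card G with hn
  have hn₀ : (0 : ℝ) < n := by exact_mod_cast Fintype.card_pos
  suffices ∀ k : ℕ, ∃ 𝓕 : Finset (Finset G), #𝓕 ≤ (2 * (n + 1) ^ (2 * m)) ^ k ∧
      ∀ A : Finset G, IsSumFree (A : Set G) → ∃ F ∈ 𝓕, A ⊆ F ∧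
        (#(schurPairs F) < δ * n ^ 2 ∨ #F + k * (δ * n / 8) ≤ n) by
    obtain ⟨𝓕, h𝓕, h⟩ := this K
    refine ⟨𝓕, h𝓕, fun A hA ↦ ?_⟩
    obtain ⟨F, hF, hAF, h⟩ := h A hA
    refine ⟨F, hF, hAF, h.resolve_right fun h ↦ ?_⟩
    have : (0 : ℝ) ≤ #F := Nat.cast_nonneg _
    nlinarith
  intro k
  induction k with
  | zero =>
    refine ⟨{univ}, by simp, fun A _ ↦ ⟨univ, by simp, subset_univ _, .inr ?_⟩⟩
    simp [hn]
  | succ k ih =>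
    obtain ⟨𝓕, h𝓕, h⟩ := ih
    have hstep : ∀ F : Finset G, ∃ 𝓝 : Finset (Finset G), #𝓝 ≤ 2 * (n + 1) ^ (2 * m) ∧
        ∀ A ⊆ F, IsSumFree (A : Set G) → ∃ F' ∈ 𝓝, A ⊆ F' ∧
          (#(schurPairs F') < δ * n ^ 2 ∨
            δ * n ^ 2 ≤ #(schurPairs F) ∧ #F' + δ * n / 8 ≤ #F) := by
      intro F
      rcases lt_or_ge (#(schurPairs F) : ℝ) (δ * n ^ 2) with hF | hF
      · refine ⟨{F}, ?_, fun A hA _ ↦ ⟨F, mem_singleton_self _, hA, .inl hF⟩⟩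
        have : 0 < (n + 1) ^ (2 * m) := by positivity
        rw [card_singleton]
        omega
      · obtain ⟨𝓝, h𝓝, h⟩ := exists_shrinking_family hδ hm hm' hF
        refine ⟨𝓝, h𝓝, fun A hAF hA ↦ ?_⟩
        obtain ⟨F', hF', hAF', h⟩ := h A hAF hA
        exact ⟨F', hF', hAF', .inr ⟨hF, h⟩⟩
    choose 𝓝 h𝓝 hsub using hstep
    refine ⟨𝓕.biUnion 𝓝, ?_, fun A hA ↦ ?_⟩
    · calc #(𝓕.biUnion 𝓝) ≤ #𝓕 * (2 * (n + 1) ^ (2 * m)) :=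
            card_biUnion_le_card_mul _ _ _ fun F _ ↦ h𝓝 F
        _ ≤ (2 * (n + 1) ^ (2 * m)) ^ (k + 1) := by
            rw [pow_succ]
            exact Nat.mul_le_mul_right _ h𝓕
    · obtain ⟨F, hF, hAF, h⟩ := h A hA
      obtain ⟨F', hF', hAF', h'⟩ := hsub F A hAF hA
      refine ⟨F', mem_biUnion.2 ⟨F, hF, hF'⟩, hAF', h'.imp_right fun ⟨hge, h'⟩ ↦ ?_⟩
      have := h.resolve_left (not_lt.2 hge)
      push_cast
      linarith

end Container

section Counting

variable {t : ℕ}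

lemma card_maximalSumFree_filter_subset_le {ε c : ℝ} (hc₁ : 1 ≤ c) (hc : ∀ k : ℕ, (k : ℝ) ≤ c ^ k)
    {F : Finset ((Fin t → ZMod 2) × ZMod 4)}
    (hF : #(schurPairs F) < SimpleGraph.triangleRemovalBound (ε / 27) *
      Fintype.card ((Fin t → ZMod 2) × ZMod 4) ^ 2) :
    (#((maximalSumFree ((Fin t → ZMod 2) × ZMod 4)).filter fun A ↦ A ⊆ F) : ℝ) ≤
      2 ^ (ε * Fintype.card ((Fin t → ZMod 2) × ZMod 4)) *
        c ^ (2 * Fintype.card ((Fin t → ZMod 2) × ZMod 4) / 5) := by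
  obtain ⟨B, -, hB, hFB⟩ := exists_isSumFree_subset_of_card_schurPairs_lt hF
  obtain ⟨B', hBB', hB'⟩ := exists_superset_card_filter_sdiff_le hB hc₁ hc
  have hmaps : ∀ A ∈ (maximalSumFree ((Fin t → ZMod 2) × ZMod 4)).filter fun A ↦ A ⊆ F,
      A \ B' ∈ (F \ B).powerset := fun A hA ↦
    mem_powerset.2 (sdiff_subset_sdiff (mem_filter.1 hA).2 hBB')
  rw [card_eq_sum_card_fiberwise hmaps, Nat.cast_sum]
  refine (sum_le_card_nsmul _ _ _ fun U _ ↦ (Nat.cast_le.2 (card_le_card ?_)).trans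
    (hB' U)).trans ?_
  · exact filter_subset_filter _ (filter_subset _ _)
  · rw [nsmul_eq_mul, card_powerset]
    have : 0 ≤ c := by linarith
    gcongr
    push_cast
    rw [← Real.rpow_natCast]
    exact Real.rpow_le_rpow_of_exponent_le one_le_two hFB

lemma card_maximalSumFree_le {ε c : ℝ} (hc₁ : 1 ≤ c) (hc : ∀ k : ℕ, (k : ℝ) ≤ c ^ k)
    {𝓕 : Finset (Finset ((Fin t → ZMod 2) × ZMod 4))}
    (h𝓕 : ∀ A : Finset ((Fin t → ZMod 2) × ZMod 4),
      IsSumFree (A : Set ((Fin t → ZMod 2) × ZMod 4)) → ∃ F ∈ 𝓕, A ⊆ F ∧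
      #(schurPairs F) < SimpleGraph.triangleRemovalBound (ε / 27) *
        Fintype.card ((Fin t → ZMod 2) × ZMod 4) ^ 2) :
    (#(maximalSumFree ((Fin t → ZMod 2) × ZMod 4)) : ℝ) ≤
      #𝓕 * (2 ^ (ε * Fintype.card ((Fin t → ZMod 2) × ZMod 4)) *
        c ^ (2 * Fintype.card ((Fin t → ZMod 2) × ZMod 4) / 5)) := by
  classical
  set 𝓕' := 𝓕.filter fun F ↦ #(schurPairs F) < SimpleGraph.triangleRemovalBound (ε / 27) *
    Fintype.card ((Fin t → ZMod 2) × ZMod 4) ^ 2 with h𝓕'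
  have hsub : maximalSumFree ((Fin t → ZMod 2) × ZMod 4) ⊆
      𝓕'.biUnion fun F ↦ (maximalSumFree _).filter fun A ↦ A ⊆ F := by
    intro A hA
    obtain ⟨F, hF, hAF, h⟩ := h𝓕 A (mem_maximalSumFree.1 hA).1
    exact mem_biUnion.2 ⟨F, mem_filter.2 ⟨hF, h⟩, mem_filter.2 ⟨hA, hAF⟩⟩
  refine (Nat.cast_le.2 ((card_le_card hsub).trans card_biUnion_le)).trans ?_
  rw [Nat.cast_sum]
  refine (sum_le_card_nsmul _ _ _ fun F hF ↦
    card_maximalSumFree_filter_subset_le hc₁ hc (mem_filter.1 hF).2).trans ?_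
  rw [nsmul_eq_mul]
  have : 0 ≤ c := by linarith
  gcongr
  exact filter_subset _ _

lemma card_group (t : ℕ) : Fintype.card ((Fin t → ZMod 2) × ZMod 4) = 2 ^ t * 4 := by
  simp [ZMod.card]

lemma two_pow_mul_two_le_sumFreeMu (t : ℕ) :
    2 ^ t * 2 ≤ sumFreeMu ((Fin t → ZMod 2) × ZMod 4) := by
  refine le_csSup ⟨Fintype.card ((Fin t → ZMod 2) × ZMod 4), ?_⟩
    ⟨((univ ×ˢ {1, 3} : Finset ((Fin t → ZMod 2) × ZMod 4)) : Set _), ?_, ?_⟩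
  · rintro _ ⟨A, -, rfl⟩
    rw [← Nat.card_eq_fintype_card, ← Set.ncard_univ]
    exact Set.ncard_le_ncard (Set.subset_univ _)
  · rintro ⟨x, a⟩ hx ⟨y, b⟩ hy h
    simp only [coe_product, coe_univ, Set.mem_prod, Set.mem_univ, true_and, mem_coe,
      Prod.mk_add_mk] at hx hy h
    revert a b
    decide
  · rw [Set.ncard_coe_finset, card_product, card_univ]
    simp [ZMod.card]
    decide

/-- A choice of parameters for the container lemma giving `2 ^ o(|G|)` containers. -/
lemma exists_container_parameters {δ : ℝ} (hδ : 0 < δ) (K : ℕ) :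
    ∃ t₀ : ℕ, ∀ t ≥ t₀, ∃ m : ℕ, 4 * (2 ^ t * 4 : ℝ) ≤ δ * m ^ 2 ∧ 8 * m ≤ δ * (2 ^ t * 4) ∧
      K * (1 + 2 * m * (t + 3)) ≤ (2 ^ t * 4 : ℝ) / 400 := by
  obtain ⟨C, hC₁, hC₂, hC₃⟩ : ∃ C : ℝ, 1 ≤ C ∧ 16 / δ ≤ C ∧ 2400 * K ≤ C :=
    ⟨max 1 (max (16 / δ) (2400 * K)), by simp, by simp, by simp⟩
  have h₁ : ∀ᶠ u : ℕ in Filter.atTop, (u : ℝ) ^ 4 / 2 ^ u < 1 / (2 * C) :=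
    (tendsto_pow_const_div_const_pow_of_one_lt 4 one_lt_two).eventually_lt_const (by positivity)
  have h₂ : ∀ᶠ u : ℕ in Filter.atTop, C ≤ u :=
    tendsto_natCast_atTop_atTop.eventually_ge_atTop C
  obtain ⟨t₀, ht₀⟩ := Filter.eventually_atTop.1 (h₁.and h₂)
  refine ⟨t₀, fun t ht ↦ ?_⟩
  obtain ⟨h₁, h₂⟩ := ht₀ (t + 3) (by omega)
  obtain ⟨u, hu⟩ : ∃ u : ℝ, u = t + 3 := ⟨_, rfl⟩
  obtain ⟨n, hn⟩ : ∃ n : ℝ, n = 2 ^ t * 4 := ⟨_, rfl⟩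
  rw [div_lt_div_iff₀ (by positivity) (by positivity), pow_add] at h₁
  push_cast at h₁ h₂
  rw [← hu] at h₁ h₂
  rw [← hu, ← hn]
  have hCn : C * u ^ 4 ≤ n := by rw [hn]; linarith
  have hu₁ : 1 ≤ u := hC₁.trans h₂
  have hn₀ : 0 < n := by rw [hn]; positivity
  have hδC : 16 ≤ C * δ := (div_le_iff₀ hδ).1 hC₂
  have hK : (0 : ℝ) ≤ K := K.cast_nonneg
  have hu₄ : u ≤ u ^ 4 := le_self_pow₀ hu₁ (by norm_num)
  have hle : n / u ^ 2 ≤ ⌈n / u ^ 2⌉₊ := Nat.le_ceil _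
  have hlt : (⌈n / u ^ 2⌉₊ : ℝ) ≤ n / u ^ 2 + 1 := (Nat.ceil_lt_add_one (by positivity)).le
  have hdiv : n / u ^ 2 ≤ n / u :=
    div_le_div_of_nonneg_left hn₀.le (by positivity) (le_self_pow₀ hu₁ (by norm_num))
  refine ⟨⌈n / u ^ 2⌉₊, ?_, ?_, ?_⟩
  · have h : 4 * u ^ 4 ≤ δ * n := by
      have : δ * (C * u ^ 4) ≤ δ * n := by gcongr
      have : 16 * u ^ 4 ≤ C * δ * u ^ 4 := by gcongr
      nlinarith [pow_pos (zero_lt_one.trans_le hu₁) 4]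
    calc 4 * n ≤ δ * (n / u ^ 2) ^ 2 := by
          rw [div_pow, ← pow_mul, show 2 * 2 = 4 by rfl, mul_div_assoc',
            le_div_iff₀ (by positivity)]
          linarith [mul_le_mul_of_nonneg_right h hn₀.le]
      _ ≤ _ := by gcongr
  · have h₃ : n / u ≤ δ * n / 16 := by
      rw [div_le_iff₀ (by positivity)]
      have : 16 ≤ u * δ := hδC.trans (by gcongr)
      nlinarith
    have h₄ : 16 ≤ δ * n := by nlinarith
    linarith
  · have h₃ : K * (n / u) ≤ n / 2400 := by
      rw [mul_div_assoc', div_le_iff₀ (by positivity)]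
      nlinarith
    have h₄ : 2400 * K * u ≤ n := (by gcongr : _ ≤ C * u ^ 4).trans hCn
    have h₅ : (⌈n / u ^ 2⌉₊ : ℝ) * u ≤ n / u + u := by
      calc _ ≤ (n / u ^ 2 + 1) * u := by gcongr
        _ = n / u + u := by field_simp
    have h₆ : (K : ℝ) * (⌈n / u ^ 2⌉₊ * u) ≤ K * (n / u + u) := by gcongr
    have h₇ : (K : ℝ) ≤ K * u := le_mul_of_one_le_right hK hu₁
    nlinarith

lemma natCast_le_three_halves_pow (k : ℕ) : (k : ℝ) ≤ (3 / 2) ^ k := by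
  match k with
  | 0 => norm_num
  | 1 => norm_num
  | k + 2 =>
    induction k with
    | zero => norm_num
    | succ k ih =>
      rw [show k + 1 + 2 = (k + 2) + 1 by rfl, pow_succ]
      push_cast at ih ⊢
      linarith [(k.cast_nonneg : (0 : ℝ) ≤ k)]

lemma three_halves_pow_le (n : ℕ) : ((3 / 2 : ℝ)) ^ (2 * n / 5) ≤ 2 ^ (6 / 25 * n : ℝ) := by
  have h : (3 / 2 : ℝ) ≤ 2 ^ (3 / 5 : ℝ) := by
    refine le_of_pow_le_pow_left₀ (n := 5) (by norm_num) (by positivity) ?_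
    rw [← Real.rpow_natCast (2 ^ (3 / 5 : ℝ)), ← Real.rpow_mul (by norm_num)]
    norm_num
  calc _ ≤ ((2 : ℝ) ^ (3 / 5 : ℝ)) ^ (2 * n / 5) := by gcongr
    _ = 2 ^ (3 / 5 * (2 * n / 5 : ℕ) : ℝ) := by
      rw [← Real.rpow_natCast, ← Real.rpow_mul (by norm_num)]
    _ ≤ _ := by
      refine Real.rpow_le_rpow_of_exponent_le one_le_two ?_
      have : ((2 * n / 5 : ℕ) : ℝ) ≤ (2 * n : ℕ) / (5 : ℕ) := Nat.cast_div_le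
      push_cast at this
      linarith

end Counting

end SumFree

open SumFree in
theorem few_maximal_sumfree_sets_Z2t_Z4 :
    ∃ c : ℝ, c > 0 ∧ ∃ t₀ : ℕ, ∀ t : ℕ, t ≥ t₀ →
      (fMaxSF ((Fin t → ZMod 2) × ZMod 4) : ℝ) ≤
        2 ^ ((1 / 2 - c) * sumFreeMu ((Fin t → ZMod 2) × ZMod 4)) := by
  obtain ⟨δ, hδ⟩ : ∃ δ, δ = SimpleGraph.triangleRemovalBound (1 / 400 / 27 : ℝ) := ⟨_, rfl⟩
  have hδ₀ : 0 < δ := hδ ▸ SimpleGraph.triangleRemovalBound_pos (by norm_num)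
  obtain ⟨K, hK⟩ := exists_nat_gt (8 / δ)
  obtain ⟨t₀, ht₀⟩ := exists_container_parameters hδ₀ K
  refine ⟨1 / 100, by norm_num, t₀, fun t ht ↦ ?_⟩
  obtain ⟨m, hm₁, hm₂, hm₃⟩ := ht₀ t ht
  have hcard : (Fintype.card ((Fin t → ZMod 2) × ZMod 4) : ℝ) = 2 ^ t * 4 := by
    rw [card_group]
    push_cast
    rfl
  rw [← hcard] at hm₁ hm₂ hm₃
  obtain ⟨𝓕, h𝓕, hcont⟩ := exists_containers hδ₀ hm₁ hm₂ ((div_lt_iff₀' hδ₀).1 hK)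
  rw [hδ] at hcont
  have hle := card_maximalSumFree_le (by norm_num) natCast_le_three_halves_pow hcont
  rw [← fMaxSF_eq_card] at hle
  have h𝓕' : (𝓕.card : ℝ) ≤ 2 ^ ((Fintype.card ((Fin t → ZMod 2) × ZMod 4) : ℝ) / 400) := by
    have h₁ : Fintype.card ((Fin t → ZMod 2) × ZMod 4) + 1 ≤ 2 ^ (t + 3) := by
      rw [card_group, pow_add]
      have := Nat.one_le_two_pow (n := t)
      omega
    have h₂ : 𝓕.card ≤ 2 ^ (K * (1 + 2 * m * (t + 3))) := by
      calc _ ≤ _ := h𝓕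
        _ ≤ (2 * (2 ^ (t + 3)) ^ (2 * m)) ^ K := by gcongr
        _ = _ := by
          rw [← pow_mul, ← pow_succ', ← pow_mul]
          ring_nf
    calc (𝓕.card : ℝ) ≤ 2 ^ (K * (1 + 2 * m * (t + 3))) := by exact_mod_cast h₂
      _ ≤ _ := by
        rw [← Real.rpow_natCast]
        refine Real.rpow_le_rpow_of_exponent_le one_le_two ?_
        push_cast
        exact hm₃
  have hμ : (Fintype.card ((Fin t → ZMod 2) × ZMod 4) : ℝ) ≤
      2 * sumFreeMu ((Fin t → ZMod 2) × ZMod 4) := by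
    have := two_pow_mul_two_le_sumFreeMu t
    rw [card_group]
    exact_mod_cast (by omega : 2 ^ t * 4 ≤ 2 * sumFreeMu ((Fin t → ZMod 2) × ZMod 4))
  refine hle.trans ((mul_le_mul h𝓕' (mul_le_mul_of_nonneg_left (three_halves_pow_le _)
    (by positivity)) (by positivity) (by positivity)).trans ?_)
  rw [← Real.rpow_add two_pos, ← Real.rpow_add two_pos]
  exact Real.rpow_le_rpow_of_exponent_le one_le_two (by linarith)
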